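/- Let ρ : ℝ³ → [0,1] be a C^∞ function with ρ ≡ 1 on the closed unit ball of ℝ³ and support contained in the open ball of radius 2 centred at 0. For λ ∈ ℝ define the vector fields on ℝ³: X_1^{(λ)} = ∂/∂x¹ and X_2^{(λ)} = ∂/∂x² + (x¹ + λ·(x¹)⁵·√|x¹|·ρ(x)) ∂/∂x³. Then there exists δ > 0 such that for every λ with |λ| < δ, any two points x, x′ ∈ ℝ³ can be joined by a continuous curve that is a finite concatenation of C¹ arcs, each with nowhere-vanishing derivative tangent at every point y to span{X_1^{(λ)}(y), X_2^{(λ)}(y)}. -/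

import Mathlib

noncomputable section
open Set

variable {E : Type*} [NormedAddCommGroup E] [NormedSpace ℝ E]

/-- A single C¹ regular arc contained in `U`, with nowhere-vanishing derivative tangent
at every point to the distribution `D`, joining `a` to `b`. -/
def IsDArc (U : Set E) (D : E → Submodule ℝ E) (a b : E) : Prop :=
  ∃ γ γ' : ℝ → E,
    γ 0 = a ∧ γ 1 = b ∧ (∀ t ∈ Icc (0:ℝ) 1, γ t ∈ U) ∧
    ContinuousOn γ' (Icc (0:ℝ) 1) ∧
    ∀ t ∈ Icc (0:ℝ) 1, HasDerivWithinAt γ (γ' t) (Icc (0:ℝ) 1) t ∧ γ' t ≠ 0 ∧ γ' t ∈ D (γ t)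

/-- Joined by a D-path: a finite concatenation of D-arcs. -/
def DJoined (U : Set E) (D : E → Submodule ℝ E) : E → E → Prop :=
  Relation.ReflTransGen (IsDArc U D)

/-- Straight segments with direction tangent to `D` are D-paths. -/
theorem DJoined_segment (D : E → Submodule ℝ E) (a v : E)
    (h : ∀ t : ℝ, v ∈ D (a + t • v)) : DJoined Set.univ D a (a + v) := by
  by_cases hv : v = 0
  · subst hv
    rw [add_zero]
    exact Relation.ReflTransGen.refl
  · refine Relation.ReflTransGen.single ⟨fun t => a + t • v, fun _ => v, by simp, by simp,
      fun _ _ => mem_univ _, continuousOn_const, fun t _ => ⟨?_, hv, h t⟩⟩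
    have := ((hasDerivAt_id t).smul_const v).const_add a
    simpa using this.hasDerivWithinAt

/-- **Connectivity for a low-regularity perturbation of the contact structure.**
Let `ρ : ℝ³ → [0,1]` be C^∞, `ρ ≡ 1` on the closed unit ball and with support in the open
ball of radius 2.  For `λ ∈ ℝ` set `X₁^{(λ)} = ∂/∂x¹` and
`X₂^{(λ)} = ∂/∂x² + (x¹ + λ·(x¹)⁵·√|x¹|·ρ(x)) ∂/∂x³`.  Then there is `δ > 0` such that
for every `λ` with `|λ| < δ`, any two points of `ℝ³` are joined by a piecewise C¹ path
whose arcs have nowhere-vanishing derivative tangent at each point `y` to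
`span{X₁^{(λ)}(y), X₂^{(λ)}(y)}`. -/
theorem perturbed_contact_structure_connected
    (ρ : EuclideanSpace ℝ (Fin 3) → ℝ)
    (hρ_smooth : ContDiff ℝ (⊤ : ℕ∞) ρ)
    (hρ_range : ∀ x, ρ x ∈ Icc (0 : ℝ) 1)
    (hρ_one : ∀ x ∈ Metric.closedBall (0 : EuclideanSpace ℝ (Fin 3)) 1, ρ x = 1)
    (hρ_supp : tsupport ρ ⊆ Metric.ball (0 : EuclideanSpace ℝ (Fin 3)) 2) :
    ∃ δ > (0 : ℝ), ∀ lam : ℝ, |lam| < δ →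
      ∀ x x' : EuclideanSpace ℝ (Fin 3),
        DJoined Set.univ
          (fun y : EuclideanSpace ℝ (Fin 3) =>
            Submodule.span ℝ
              {(!₂[(1 : ℝ), 0, 0] : EuclideanSpace ℝ (Fin 3)),
               (!₂[(0 : ℝ), 1,
                  y 0 + lam * (y 0) ^ 5 * Real.sqrt |y 0| * ρ y] :
                  EuclideanSpace ℝ (Fin 3))})
          x x' := by
  refine ⟨1, one_pos, fun lam _ x x' => ?_⟩
  have hzero : ∀ y : EuclideanSpace ℝ (Fin 3), 3 ≤ y 0 → ρ y = 0 := by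
    intro y hy
    by_contra hne
    have h1 := hρ_supp (subset_tsupport ρ hne)
    rw [mem_ball_zero_iff] at h1
    have h2 := PiLp.norm_apply_le y 0
    rw [Real.norm_eq_abs] at h2
    linarith [le_abs_self (y 0)]
  set D : EuclideanSpace ℝ (Fin 3) → Submodule ℝ (EuclideanSpace ℝ (Fin 3)) :=
    (fun y : EuclideanSpace ℝ (Fin 3) =>
            Submodule.span ℝ
              {(!₂[(1 : ℝ), 0, 0] : EuclideanSpace ℝ (Fin 3)),
               (!₂[(0 : ℝ), 1,
                  y 0 + lam * (y 0) ^ 5 * Real.sqrt |y 0| * ρ y] :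
                  EuclideanSpace ℝ (Fin 3))}) with hD
  have move1 : ∀ p q r p' : ℝ, DJoined Set.univ D !₂[p, q, r] !₂[p', q, r] := by
    intro p q r p'
    have h := DJoined_segment D !₂[p, q, r] ((p' - p) • !₂[(1 : ℝ), 0, 0])
      (fun t => Submodule.smul_mem _ _ (Submodule.subset_span (by simp)))
    convert h using 1
    ext i
    fin_cases i <;> simp
  have move2 : ∀ p q r s : ℝ, 3 ≤ p →
      DJoined Set.univ D !₂[p, q, r] !₂[p, q + s, r + p * s] := by
    intro p q r s hp
    have h := DJoined_segment D !₂[p, q, r] (s • !₂[(0 : ℝ), 1, p]) (fun t => by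
      apply Submodule.smul_mem
      apply Submodule.subset_span
      have h0 : (!₂[p, q, r] + t • s • !₂[(0 : ℝ), 1, p] : EuclideanSpace ℝ (Fin 3)) 0 = p := by
        simp
      have hz := hzero _ (by rw [h0]; exact hp)
      rw [hz, h0]
      simp)
    convert h using 1
    ext i
    fin_cases i <;> simp [mul_comm]
  have hx : ∀ z : EuclideanSpace ℝ (Fin 3), z = !₂[z 0, z 1, z 2] := by
    intro z
    ext i
    fin_cases i <;> simp
  rw [hx x, hx x']
  generalize x 0 = a, x 1 = b, x 2 = c, x' 0 = a', x' 1 = b', x' 2 = c'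
  have t1 := move1 a b c 3
  have t2 := move2 3 b c ((b' - b) - (c' - c - 3 * (b' - b))) le_rfl
  have t3 := move1 3 (b + ((b' - b) - (c' - c - 3 * (b' - b))))
    (c + 3 * ((b' - b) - (c' - c - 3 * (b' - b)))) 4
  have t4 := move2 4 (b + ((b' - b) - (c' - c - 3 * (b' - b))))
    (c + 3 * ((b' - b) - (c' - c - 3 * (b' - b)))) (c' - c - 3 * (b' - b)) (by norm_num)
  have t5 := move1 4 b' c' a'
  have e1 : b + ((b' - b) - (c' - c - 3 * (b' - b))) + (c' - c - 3 * (b' - b)) = b' := by ring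
  have e2 : c + 3 * ((b' - b) - (c' - c - 3 * (b' - b))) + 4 * (c' - c - 3 * (b' - b)) = c' := by
    ring
  rw [e1, e2] at t4
  exact (((t1.trans t2).trans t3).trans t4).trans t5
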